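/- Let I₀, I₁ be complex structures on a real Hilbert space H, T₀ = (I₀+I₁)/2, T₁ = (I₀−I₁)/2. If v is an eigenvector of T₀*T₀ with eigenvalue λ ∈ (0,1), then w = T₁*T₀ v satisfies ‖w‖² = λ(1−λ)‖v‖², T₀*T₀ w = λ w, and w is not of the form (μ₀ + μ₁ I₀)v for any real μ₀, μ₁. -/

import Mathlib

open ContinuousLinearMap

/-- If `v` is an eigenvector of `T₀*T₀` with eigenvalue `μ ∈ (0,1)`,
then `w = T₁*T₀ v` satisfies `‖w‖² = μ(1−μ)‖v‖²`, `T₀*T₀ w = μ w`, and `w` is not of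
the form `(μ₀ + μ₁ I₀) v` for any real `μ₀, μ₁` (i.e. `v` and `w` are
`ℂ`-linearly independent for the complex structure `I₀`). -/
theorem eigenvector_pairing
    {H : Type*} [NormedAddCommGroup H] [InnerProductSpace ℝ H] [CompleteSpace H]
    (I₀ I₁ : H →L[ℝ] H)
    (h₀a : adjoint I₀ = -I₀) (h₀sq : I₀ * I₀ = -1)
    (h₁a : adjoint I₁ = -I₁) (h₁sq : I₁ * I₁ = -1)
    (μ : ℝ) (hμ : μ ∈ Set.Ioo (0 : ℝ) 1) (v : H) (hv : v ≠ 0)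
    (heig : (adjoint ((2⁻¹ : ℝ) • (I₀ + I₁)) * ((2⁻¹ : ℝ) • (I₀ + I₁))) v = μ • v) :
    let T₀ := (2⁻¹ : ℝ) • (I₀ + I₁)
    let T₁ := (2⁻¹ : ℝ) • (I₀ - I₁)
    let w := (adjoint T₁ * T₀) v
    ‖w‖ ^ 2 = μ * (1 - μ) * ‖v‖ ^ 2 ∧
    (adjoint T₀ * T₀) w = μ • w ∧
    ∀ μ₀ μ₁ : ℝ, w ≠ μ₀ • v + μ₁ • (I₀ v) := by
  intro T₀ T₁ w
  obtain ⟨hμ0, hμ1⟩ := hμ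
  have aa : ∀ x, I₀ (I₀ x) = -x := fun x => by
    simpa using congrArg (fun f : H →L[ℝ] H => f x) h₀sq
  have bb : ∀ x, I₁ (I₁ x) = -x := fun x => by
    simpa using congrArg (fun f : H →L[ℝ] H => f x) h₁sq
  have ia : ∀ x y, inner ℝ (I₀ x) y = -inner ℝ x (I₀ y) := fun x y => by
    rw [← ContinuousLinearMap.adjoint_inner_right, h₀a]; simp
  have ib : ∀ x y, inner ℝ (I₁ x) y = -inner ℝ x (I₁ y) := fun x y => by
    rw [← ContinuousLinearMap.adjoint_inner_right, h₁a]; simp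
  have na : ∀ x, ‖I₀ x‖ ^ 2 = ‖x‖ ^ 2 := fun x => by
    rw [← real_inner_self_eq_norm_sq, ia, aa, inner_neg_right, neg_neg,
      real_inner_self_eq_norm_sq]
  have nb : ∀ x, ‖I₁ x‖ ^ 2 = ‖x‖ ^ 2 := fun x => by
    rw [← real_inner_self_eq_norm_sq, ib, bb, inner_neg_right, neg_neg,
      real_inner_self_eq_norm_sq]
  have za : ∀ x, inner ℝ (I₀ x) x = 0 := fun x => by
    have := ia x x
    rw [real_inner_comm (I₀ x) x] at this
    linarith
  have zb : ∀ x, inner ℝ (I₁ x) x = 0 := fun x => by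
    have := ib x x
    rw [real_inner_comm (I₁ x) x] at this
    linarith
  have hT : ∀ x, (adjoint T₀ * T₀) x
      = (4⁻¹ : ℝ) • ((2 : ℝ) • x - I₀ (I₁ x) - I₁ (I₀ x)) := fun x => by
    simp only [T₀, map_smulₛₗ, map_add, h₀a, h₁a, mul_apply_eq_comp,
      _root_.smul_apply, _root_.add_apply,
      _root_.neg_apply, RingHom.id_apply, aa, bb, conj_trivial]
    module
  have hw : w = (4⁻¹ : ℝ) • (I₁ (I₀ v) - I₀ (I₁ v)) := by
    simp only [w, T₀, T₁, map_smulₛₗ, map_add, map_sub, h₀a, h₁a,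
      mul_apply_eq_comp, _root_.sub_apply,
      _root_.smul_apply, _root_.add_apply,
      _root_.neg_apply, RingHom.id_apply, aa, bb, conj_trivial]
    module
  have hE : (4⁻¹ : ℝ) • ((2 : ℝ) • v - I₀ (I₁ v) - I₁ (I₀ v)) = μ • v := by
    rw [← hT]; exact heig
  have hC : I₁ (I₀ v) + I₀ (I₁ v) = (2 - 4 * μ) • v := by
    have h4 := congrArg (fun x => (4 : ℝ) • x) hE
    simp only [smul_smul] at h4
    norm_num at h4
    rw [sub_smul, ← h4]
    module
  have hN : ‖w‖ ^ 2 = μ * (1 - μ) * ‖v‖ ^ 2 := by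
    have h1 := parallelogram_law_with_norm ℝ (I₁ (I₀ v)) (I₀ (I₁ v))
    have h2 : ‖I₁ (I₀ v) + I₀ (I₁ v)‖ ^ 2 = (2 - 4 * μ) ^ 2 * ‖v‖ ^ 2 := by
      rw [hC, norm_smul, mul_pow, Real.norm_eq_abs, sq_abs]
    have h3 : ‖I₁ (I₀ v)‖ ^ 2 = ‖v‖ ^ 2 := by rw [nb, na]
    have h4 : ‖I₀ (I₁ v)‖ ^ 2 = ‖v‖ ^ 2 := by rw [na, nb]
    rw [hw, norm_smul, mul_pow, Real.norm_eq_abs, sq_abs]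
    linarith
  refine ⟨hN, ?_, ?_⟩
  · have e1 : I₁ (I₀ v) = (2 - 4 * μ) • v - I₀ (I₁ v) := eq_sub_of_add_eq hC
    have e2 : I₁ (I₀ (I₁ v)) = (2 - 4 * μ) • I₁ v + I₀ v := by
      have := congrArg I₁ hC
      simp only [map_add, bb, map_smul] at this
      rw [← this]; abel
    rw [hT, hw]
    simp only [map_smul, map_sub, aa, bb, e1, e2, map_add, map_neg]
    module
  · intro c d h
    have hp : inner ℝ w v = 0 := by
      rw [hw, inner_smul_left, inner_sub_left, ib (I₀ v) v, ia (I₁ v) v,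
        real_inner_comm (I₀ v) (I₁ v)]
      simp
    have hq : inner ℝ w (I₀ v) = 0 := by
      rw [hw, inner_smul_left, inner_sub_left, zb, ia (I₁ v), aa, inner_neg_right, zb]
      simp
    have h0 : ‖w‖ ^ 2 = 0 := by
      rw [← real_inner_self_eq_norm_sq]
      nth_rewrite 2 [h]
      rw [inner_add_right, inner_smul_right, inner_smul_right, hp, hq]; simp
    have : 0 < ‖v‖ := norm_pos_iff.mpr hv
    have : 0 < μ * (1 - μ) * ‖v‖ ^ 2 := by
      have : 0 < 1 - μ := by linarith
      positivity
    linarith
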